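/- arXiv:1610.03002 — 2 statements merged into one kernel-verified Lean document; each statement's English description precedes it below -/
import Mathlib

section
/- Let u₁, …, uₙ ≥ 0 be utilities and w₁, …, wₙ > 0 be weights sorted so that u₁/w₁ ≥ u₂/w₂ ≥ … ≥ uₙ/wₙ, let C ≥ 0, and suppose t ∈ {1, …, n} satisfies ∑_{k=1}^{t−1} wₖ ≤ C and ∑_{k=1}^{t} wₖ > C. Then every fractional solution x ∈ [0,1]ⁿ with ∑_{k=1}^{n} wₖ·xₖ ≤ C satisfies ∑_{k=1}^{n} uₖ·xₖ ≤ ∑_{k=1}^{t−1} uₖ + (C − ∑_{k=1}^{t−1} wₖ)·(u_t/w_t). -/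
open Finset

/-- Greedy-choice optimality bound for the fractional knapsack: if the items are sorted
in nonincreasing order of efficiency `uₖ/wₖ` and `t` is the first index at which the
greedy prefix exceeds the capacity `C`, then every fractional feasible solution has
value at most that of the greedy fractional solution. -/
theorem fractional_knapsack_greedy_bound
    (n : ℕ) (u w : Fin n → ℝ)
    (hu : ∀ k, 0 ≤ u k) (hw : ∀ k, 0 < w k)
    (hsorted : ∀ i j : Fin n, i ≤ j → u j / w j ≤ u i / w i)
    (C : ℝ) (hC : 0 ≤ C)
    (t : Fin n)
    (ht1 : ∑ k ∈ Finset.Iio t, w k ≤ C)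
    (ht2 : C < ∑ k ∈ Finset.Iic t, w k) :
    ∀ x : Fin n → ℝ, (∀ k, 0 ≤ x k ∧ x k ≤ 1) →
      ∑ k, w k * x k ≤ C →
      ∑ k, u k * x k ≤
        ∑ k ∈ Finset.Iio t, u k + (C - ∑ k ∈ Finset.Iio t, w k) * (u t / w t) := by
  intro x hx hxC
  set r := u t / w t with hr
  have hr0 : 0 ≤ r := div_nonneg (hu t) (hw t).le
  have h1 : ∑ k, (u k - r * w k) * x k ≤ ∑ k, (if k ∈ Finset.Iio t then u k - r * w k else 0) := by
    apply Finset.sum_le_sum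
    intro k _
    obtain ⟨h0, h1⟩ := hx k
    split_ifs with hk
    · have h := hsorted k t (Finset.mem_Iio.mp hk).le
      rw [← hr, le_div_iff₀ (hw k)] at h
      nlinarith
    · have h := hsorted t k (not_lt.mp fun h => hk (Finset.mem_Iio.mpr h))
      rw [← hr, div_le_iff₀ (hw k)] at h
      nlinarith
  rw [Finset.sum_ite_mem, Finset.univ_inter, Finset.sum_sub_distrib, ← Finset.mul_sum] at h1
  have h2 : ∑ k, (u k - r * w k) * x k = ∑ k, u k * x k - r * ∑ k, w k * x k := by
    rw [Finset.mul_sum, ← Finset.sum_sub_distrib]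
    exact Finset.sum_congr rfl fun k _ => by ring
  have h3 := mul_le_mul_of_nonneg_left hxC hr0
  rw [h2] at h1
  linarith
end

section
/- Let u₁, …, uₙ ≥ 0 be utilities and w₁, …, wₙ > 0 be weights sorted so that u₁/w₁ ≥ u₂/w₂ ≥ … ≥ uₙ/wₙ, let C ≥ 0, and suppose t ∈ {1, …, n} satisfies ∑_{k=1}^{t−1} wₖ ≤ C and ∑_{k=1}^{t} wₖ > C. Then every fractional solution x ∈ [0,1]ⁿ with ∑_{k=1}^{n} wₖ·xₖ ≤ C satisfies ∑_{k=1}^{n} uₖ·xₖ ≤ ∑_{k=1}^{t−1} uₖ + max_{1 ≤ k ≤ n} uₖ. -/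
open Finset

/-- The optimal value of the fractional knapsack relaxation exceeds the greedy integral
prefix value by at most the maximum single-item utility. -/
theorem fractional_knapsack_le_prefix_add_max
    (n : ℕ) (u w : Fin n → ℝ)
    (hu : ∀ k, 0 ≤ u k) (hw : ∀ k, 0 < w k)
    (hsorted : ∀ i j : Fin n, i ≤ j → u j / w j ≤ u i / w i)
    (C : ℝ) (hC : 0 ≤ C)
    (t : Fin n)
    (ht1 : ∑ k ∈ Finset.Iio t, w k ≤ C)
    (ht2 : C < ∑ k ∈ Finset.Iic t, w k) :
    ∀ x : Fin n → ℝ, (∀ k, 0 ≤ x k ∧ x k ≤ 1) →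
      ∑ k, w k * x k ≤ C →
      ∑ k, u k * x k ≤
        ∑ k ∈ Finset.Iio t, u k + Finset.univ.sup' ⟨t, Finset.mem_univ t⟩ u := by
  intro x hx hxC
  have hmax : u t ≤ Finset.univ.sup' ⟨t, Finset.mem_univ t⟩ u :=
    Finset.le_sup' u (Finset.mem_univ t)
  obtain ⟨r, hr⟩ : ∃ r, r = u t / w t := ⟨_, rfl⟩
  have hr0 : 0 ≤ r := by rw [hr]; exact div_nonneg (hu t) (hw t).le
  have hrt : r * w t = u t := by rw [hr]; exact div_mul_cancel₀ _ (hw t).ne'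
  have key : ∀ k, u k * x k - r * (w k * x k) ≤
      if k ∈ Finset.Iio t then u k - r * w k else 0 := by
    intro k
    obtain ⟨h0, h1⟩ := hx k
    split_ifs with h
    · have h2 := hsorted k t (Finset.mem_Iio.1 h).le
      rw [← hr, le_div_iff₀ (hw k)] at h2
      nlinarith
    · have h2 := hsorted t k (not_lt.1 (fun h' => h (Finset.mem_Iio.2 h')))
      rw [← hr, div_le_iff₀ (hw k)] at h2
      nlinarith
  have hsum := Finset.sum_le_sum (fun k (_ : k ∈ Finset.univ) => key k)
  rw [Finset.sum_ite_mem, Finset.univ_inter, Finset.sum_sub_distrib, Finset.sum_sub_distrib,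
    ← Finset.mul_sum, ← Finset.mul_sum] at hsum
  have hI : ∑ k ∈ Finset.Iic t, w k = w t + ∑ k ∈ Finset.Iio t, w k := by
    rw [← Finset.Iio_insert, Finset.sum_insert (by simp)]
  have h3 : r * (∑ k, w k * x k) ≤ r * (w t + ∑ k ∈ Finset.Iio t, w k) :=
    mul_le_mul_of_nonneg_left (by linarith) hr0
  rw [mul_add] at h3
  linarith
end
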